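/- arXiv:1104.1902 — 2 statements merged into one kernel-verified Lean document; each statement's English description precedes it below -/
import Mathlib

section
/- If S is a numerical semigroup with multiplicity 3 that is not irreducible, then the minimal decomposition of S as an intersection of two irreducible numerical semigroups is unique. -/
/-- A numerical semigroup: a subset of ℕ containing 0, closed under addition,
with finite complement. -/
def IsNumSgp (S : Set ℕ) : Prop :=
  0 ∈ S ∧ (∀ a ∈ S, ∀ b ∈ S, a + b ∈ S) ∧ (Sᶜ).Finite

/-- Multiplicity: least positive element. -/
noncomputable def nsMult (S : Set ℕ) : ℕ := sInf {n | n ∈ S ∧ 0 < n}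

/-- Frobenius number: largest integer not in S. -/
noncomputable def nsFrob (S : Set ℕ) : ℕ := sSup Sᶜ

/-- Genus: number of gaps. -/
noncomputable def nsGenus (S : Set ℕ) : ℕ := Sᶜ.ncard

/-- Special gaps of S. -/
def nsSG (S : Set ℕ) : Set ℕ := {h | h ∉ S ∧ IsNumSgp (S ∪ {h})}

/-- Special gaps of S larger than m. -/
def nsSGm (m : ℕ) (S : Set ℕ) : Set ℕ := {h ∈ nsSG S | m < h}

/-- S is irreducible: not an intersection of two numerical semigroups properly containing it. -/
def nsIrr (S : Set ℕ) : Prop :=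
  ¬ ∃ T₁ T₂ : Set ℕ, IsNumSgp T₁ ∧ IsNumSgp T₂ ∧ S ⊂ T₁ ∧ S ⊂ T₂ ∧ S = T₁ ∩ T₂

/-- S is m-irreducible: not an intersection of two numerical semigroups of
multiplicity m properly containing it. -/
def nsMIrr (m : ℕ) (S : Set ℕ) : Prop :=
  ¬ ∃ T₁ T₂ : Set ℕ, IsNumSgp T₁ ∧ IsNumSgp T₂ ∧ nsMult T₁ = m ∧ nsMult T₂ = m ∧
      S ⊂ T₁ ∧ S ⊂ T₂ ∧ S = T₁ ∩ T₂

/-- Symmetric: irreducible with odd Frobenius number. -/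
def nsSym (S : Set ℕ) : Prop := nsIrr S ∧ Odd (nsFrob S)

/-- Pseudosymmetric: irreducible with even Frobenius number. -/
def nsPseudoSym (S : Set ℕ) : Prop := nsIrr S ∧ Even (nsFrob S)

/-- m-symmetric: m-irreducible with odd Frobenius number. -/
def nsMSym (m : ℕ) (S : Set ℕ) : Prop := nsMIrr m S ∧ Odd (nsFrob S)

/-- m-pseudosymmetric: m-irreducible with even Frobenius number. -/
def nsMPseudoSym (m : ℕ) (S : Set ℕ) : Prop := nsMIrr m S ∧ Even (nsFrob S)

/-- The numerical semigroup (submonoid) generated by a set of naturals. -/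
def nsGen (A : Set ℕ) : Set ℕ := (AddSubmonoid.closure A : Set ℕ)

/-- Apéry element: least element of S congruent to i mod m. -/
noncomputable def nsApery (S : Set ℕ) (m i : ℕ) : ℕ := sInf {s | s ∈ S ∧ s % m = i % m}

/-- The set containing `3ℕ` whose least elements congruent to `1` and `2` modulo `3` are
`3 * i + 1` and `3 * j + 2`. -/
def threeSgp (i j : ℕ) : Set ℕ :=
  {n | (n % 3 = 1 → 3 * i + 1 ≤ n) ∧ (n % 3 = 2 → 3 * j + 2 ≤ n)}

theorem mem_threeSgp {i j n : ℕ} :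
    n ∈ threeSgp i j ↔ (n % 3 = 1 → 3 * i + 1 ≤ n) ∧ (n % 3 = 2 → 3 * j + 2 ≤ n) :=
  Iff.rfl

theorem one_mod_mem_threeSgp {i j k : ℕ} : 3 * k + 1 ∈ threeSgp i j ↔ i ≤ k := by
  rw [mem_threeSgp]; omega

theorem two_mod_mem_threeSgp {i j k : ℕ} : 3 * k + 2 ∈ threeSgp i j ↔ j ≤ k := by
  rw [mem_threeSgp]; omega

theorem threeSgp_subset {i j i' j' : ℕ} :
    threeSgp i j ⊆ threeSgp i' j' ↔ i' ≤ i ∧ j' ≤ j := by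
  refine ⟨fun h => ⟨one_mod_mem_threeSgp.1 (h (one_mod_mem_threeSgp.2 le_rfl)),
    two_mod_mem_threeSgp.1 (h (two_mod_mem_threeSgp.2 le_rfl))⟩, fun h n hn => ?_⟩
  rw [mem_threeSgp] at *
  omega

theorem threeSgp_inj {i j i' j' : ℕ} :
    threeSgp i j = threeSgp i' j' ↔ i = i' ∧ j = j' := by
  rw [Set.Subset.antisymm_iff, threeSgp_subset, threeSgp_subset]
  omega

theorem threeSgp_inter (i j i' j' : ℕ) :
    threeSgp i j ∩ threeSgp i' j' = threeSgp (max i i') (max j j') := by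
  ext n
  rw [Set.mem_inter_iff, mem_threeSgp, mem_threeSgp, mem_threeSgp]
  omega

theorem isNumSgp_threeSgp {i j : ℕ} (hij : i ≤ 2 * j + 1) (hji : j ≤ 2 * i) :
    IsNumSgp (threeSgp i j) := by
  refine ⟨by rw [mem_threeSgp]; omega, fun a ha b hb => ?_, ?_⟩
  · rw [mem_threeSgp] at *
    omega
  · refine (Set.finite_Iio (3 * i + 3 * j + 2)).subset fun n hn => ?_
    rw [Set.mem_compl_iff, mem_threeSgp] at hn
    rw [Set.mem_Iio]
    omega

theorem IsNumSgp.add_three_mul_mem {T : Set ℕ} (hT : IsNumSgp T) (h3 : 3 ∈ T) {n : ℕ}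
    (hn : n ∈ T) (k : ℕ) : n + 3 * k ∈ T := by
  induction k with
  | zero => exact hn
  | succ k ih => exact hT.2.1 _ ih _ h3

theorem IsNumSgp.exists_three_mul_add_mem {T : Set ℕ} (hT : IsNumSgp T) (r : ℕ) :
    ∃ k, 3 * k + r ∈ T := by
  obtain ⟨m, hm⟩ := hT.2.2.bddAbove
  by_contra! h
  have := hm (h (m + 1))
  omega

theorem IsNumSgp.exists_eq_threeSgp {T : Set ℕ} (hT : IsNumSgp T) (h3 : 3 ∈ T) :
    ∃ i j, i ≤ 2 * j + 1 ∧ j ≤ 2 * i ∧ T = threeSgp i j := by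
  classical
  have h₁ := hT.exists_three_mul_add_mem 1
  have h₂ := hT.exists_three_mul_add_mem 2
  have hi := Nat.find_spec h₁
  have hj := Nat.find_spec h₂
  have hi' : ∀ k, 3 * k + 1 ∈ T → Nat.find h₁ ≤ k := fun k => Nat.find_min' h₁
  have hj' : ∀ k, 3 * k + 2 ∈ T → Nat.find h₂ ≤ k := fun k => Nat.find_min' h₂
  generalize Nat.find h₁ = i at *
  generalize Nat.find h₂ = j at *
  refine ⟨i, j, hi' _ ?_, hj' _ ?_, ?_⟩
  · convert hT.2.1 _ hj _ hj using 1
    ring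
  · convert hT.2.1 _ hi _ hi using 1
    ring
  · ext n
    obtain ⟨k, rfl | rfl | rfl⟩ : ∃ k, n = 3 * k ∨ n = 3 * k + 1 ∨ n = 3 * k + 2 :=
      ⟨n / 3, by omega⟩
    · refine iff_of_true ?_ (by rw [mem_threeSgp]; omega)
      simpa using hT.add_three_mul_mem h3 hT.1 k
    · rw [one_mod_mem_threeSgp]
      refine ⟨hi' k, fun h => ?_⟩
      convert hT.add_three_mul_mem h3 hi (k - i) using 1
      omega
    · rw [two_mod_mem_threeSgp]
      refine ⟨hj' k, fun h => ?_⟩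
      convert hT.add_three_mul_mem h3 hj (k - j) using 1
      omega

theorem not_nsIrr_threeSgp {i j : ℕ} (hij : i ≤ 2 * j)
    (hji : j + 1 ≤ 2 * i) : ¬ nsIrr (threeSgp (i + 1) (j + 1)) := by
  refine not_not_intro ⟨threeSgp i (j + 1), threeSgp (i + 1) j,
    isNumSgp_threeSgp (by omega) (by omega), isNumSgp_threeSgp (by omega) (by omega), ?_, ?_, ?_⟩
  · rw [ssubset_iff_subset_ne, threeSgp_subset, Ne, threeSgp_inj]; omega
  · rw [ssubset_iff_subset_ne, threeSgp_subset, Ne, threeSgp_inj]; omega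
  · rw [threeSgp_inter, threeSgp_inj]; omega

theorem le_of_nsIrr_threeSgp {i j : ℕ} (h : nsIrr (threeSgp i j)) :
    i = 0 ∨ j = 0 ∨ 2 * j ≤ i ∨ 2 * i ≤ j + 1 := by
  obtain _ | i := i
  · exact .inl rfl
  obtain _ | j := j
  · exact .inr (.inl rfl)
  by_contra! hc
  exact not_nsIrr_threeSgp (by omega) (by omega) h

/-- An irreducible decomposition of a reducible `threeSgp i j` is determined by `i` and `j`. -/
theorem pair_eq_of_threeSgp_eq_inter {i j : ℕ} (hni : ¬ nsIrr (threeSgp i j)) {A B : Set ℕ}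
    (hA : IsNumSgp A) (hA' : nsIrr A) (hB : IsNumSgp B) (hB' : nsIrr B)
    (h : threeSgp i j = A ∩ B) :
    ({A, B} : Set (Set ℕ)) = {threeSgp i (i / 2), threeSgp ((j + 1) / 2) j} := by
  have h3 : 3 ∈ A ∩ B := h ▸ mem_threeSgp.2 (by omega)
  obtain ⟨i₁, j₁, hij₁, hji₁, rfl⟩ := hA.exists_eq_threeSgp h3.1
  obtain ⟨i₂, j₂, hij₂, hji₂, rfl⟩ := hB.exists_eq_threeSgp h3.2
  have hneA : ¬ (i = i₁ ∧ j = j₁) := fun e => hni (threeSgp_inj.2 e ▸ hA')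
  have hneB : ¬ (i = i₂ ∧ j = j₂) := fun e => hni (threeSgp_inj.2 e ▸ hB')
  rw [threeSgp_inter, threeSgp_inj] at h
  have hirrA := le_of_nsIrr_threeSgp hA'
  have hirrB := le_of_nsIrr_threeSgp hB'
  obtain hi | hi : i₁ = i ∨ i₂ = i := by omega
  · obtain ⟨rfl, rfl, rfl, rfl⟩ : i₁ = i ∧ j₁ = i / 2 ∧ i₂ = (j + 1) / 2 ∧ j₂ = j := by omega
    rfl
  · obtain ⟨rfl, rfl, rfl, rfl⟩ : i₂ = i ∧ j₂ = i / 2 ∧ i₁ = (j + 1) / 2 ∧ j₁ = j := by omega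
    exact Set.pair_comm _ _

/-- the minimal decomposition of a non-irreducible numerical
semigroup of multiplicity 3 as an intersection of two irreducible numerical
semigroups is unique. -/
theorem stmt11 (S : Set ℕ) (hS : IsNumSgp S) (hm : nsMult S = 3)
    (hni : ¬ nsIrr S) :
    ∀ A B C D : Set ℕ,
      IsNumSgp A → nsIrr A → IsNumSgp B → nsIrr B →
      IsNumSgp C → nsIrr C → IsNumSgp D → nsIrr D →
      S = A ∩ B → S = C ∩ D → ({A, B} : Set (Set ℕ)) = {C, D} := by
  intro A B C D hA hA' hB hB' hC hC' hD hD' hAB hCD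
  have h3 : 3 ∈ S := by
    have hne : {n | n ∈ S ∧ 0 < n}.Nonempty := by
      obtain ⟨k, hk⟩ := hS.exists_three_mul_add_mem 1
      exact ⟨_, hk, by omega⟩
    exact hm ▸ (Nat.sInf_mem hne).1
  obtain ⟨i, j, -, -, rfl⟩ := hS.exists_eq_threeSgp h3
  rw [pair_eq_of_threeSgp_eq_inter hni hA hA' hB hB' hAB,
    pair_eq_of_threeSgp_eq_inter hni hC hC' hD hD' hCD]
end

section
/- Let h, d be positive integers with gcd(d,4) = 1 and k ∈ {1,2,3}, and let S = ⟨4, 4h+d, ..., 4h+kd⟩. If k = 1 or k = 2 then S is irreducible and moreover symmetric (its Frobenius number, 4(3h-1)+3d when k=1 and 4(2h-1)+3d when k=2, is odd); if k = 3 then S is not irreducible. -/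
/-- The set with least elements `0`, `a`, `b`, `c` in the residue classes of `0`, `d`, `2d`, `3d`
modulo `4`. -/
def aperySetFour (d a b c : ℕ) : Set ℕ :=
  {n | n % 4 = 0 ∨ (a ≤ n ∧ n % 4 = d % 4) ∨ (b ≤ n ∧ n % 4 = 2 * d % 4) ∨
    (c ≤ n ∧ n % 4 = 3 * d % 4)}

theorem mem_aperySetFour {d a b c n : ℕ} : n ∈ aperySetFour d a b c ↔
    n % 4 = 0 ∨ (a ≤ n ∧ n % 4 = d % 4) ∨ (b ≤ n ∧ n % 4 = 2 * d % 4) ∨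
      (c ≤ n ∧ n % 4 = 3 * d % 4) :=
  Iff.rfl

theorem add_mem_aperySetFour {d a b c : ℕ} (haa : b ≤ a + a) (hab : c ≤ a + b) (hbc : a ≤ b + c) (hcc : b ≤ c + c) {x y : ℕ}
    (hx : x ∈ aperySetFour d a b c) (hy : y ∈ aperySetFour d a b c) :
    x + y ∈ aperySetFour d a b c := by
  rw [mem_aperySetFour] at *
  rcases hx with hx | hx | hx | hx <;> rcases hy with hy | hy | hy | hy <;> omega

theorem nsGen_eq_aperySetFour {G : Set ℕ} {d a b c : ℕ} (haa : b ≤ a + a) (hab : c ≤ a + b) (hbc : a ≤ b + c) (hcc : b ≤ c + c)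
    (hG : G ⊆ aperySetFour d a b c) (h4 : 4 ∈ nsGen G)
    (ha : a ∈ nsGen G) (hb : b ∈ nsGen G) (hc : c ∈ nsGen G)
    (ha4 : a % 4 = d % 4) (hb4 : b % 4 = 2 * d % 4) (hc4 : c % 4 = 3 * d % 4) :
    nsGen G = aperySetFour d a b c := by
  have above {w n : ℕ} (hw : w ∈ nsGen G) (hwn : w ≤ n) (hmod : n % 4 = w % 4) :
      n ∈ nsGen G := by
    have hn : n = w + ((n - w) / 4) • 4 := by rw [smul_eq_mul]; omega
    rw [hn]
    exact add_mem (S := AddSubmonoid ℕ) (s := AddSubmonoid.closure G) hw (nsmul_mem h4 _)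
  ext n
  constructor
  · intro hn
    induction hn using AddSubmonoid.closure_induction with
    | mem x hx => exact hG hx
    | zero => exact Or.inl rfl
    | add x y _ _ hx hy => exact add_mem_aperySetFour haa hab hbc hcc hx hy
  · rintro (hn | ⟨hn, hm⟩ | ⟨hn, hm⟩ | ⟨hn, hm⟩)
    · exact above (zero_mem (AddSubmonoid.closure G)) n.zero_le hn
    · exact above ha hn (hm.trans ha4.symm)
    · exact above hb hn (hm.trans hb4.symm)
    · exact above hc hn (hm.trans hc4.symm)

theorem finite_compl_aperySetFour {d a b c : ℕ} (hd : d % 4 = 1 ∨ d % 4 = 3) :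
    ((aperySetFour d a b c)ᶜ).Finite := by
  refine (Set.finite_Iio (a + b + c)).subset fun n hn => ?_
  rw [Set.mem_compl_iff, mem_aperySetFour] at hn
  rw [Set.mem_Iio]
  omega

theorem isNumSgp_union_singleton {S : Set ℕ} {f : ℕ} (h0 : 0 ∈ S)
    (hadd : ∀ a ∈ S, ∀ b ∈ S, a + b ∈ S) (hfin : (Sᶜ).Finite) (hff : f + f ∈ S)
    (hf : ∀ x ∈ S, x ≠ 0 → f + x ∈ S) : IsNumSgp (S ∪ {f}) := by
  have hf' : ∀ x ∈ S, f + x ∈ S ∪ {f} := fun x hx => by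
    rcases eq_or_ne x 0 with rfl | hx0
    · exact Or.inr rfl
    · exact Or.inl (hf x hx hx0)
  refine ⟨Or.inl h0, ?_, hfin.subset (Set.compl_subset_compl.2 Set.subset_union_left)⟩
  rintro x (hx | rfl) y (hy | rfl)
  · exact Or.inl (hadd x hx y hy)
  · exact add_comm y x ▸ hf' x hx
  · exact hf' y hy
  · exact Or.inl hff

/-- Two distinct special gaps give a decomposition. -/
theorem not_nsIrr_of_mem_nsSG {S : Set ℕ} {f g : ℕ} (hf : f ∈ nsSG S) (hg : g ∈ nsSG S)
    (hfg : f ≠ g) : ¬ nsIrr S := by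
  have ssub {x : ℕ} (hx : x ∉ S) : S ⊂ S ∪ {x} :=
    ⟨Set.subset_union_left, fun h => hx (h (Or.inr rfl))⟩
  refine not_not.2 ⟨S ∪ {f}, S ∪ {g}, hf.2, hg.2, ssub hf.1, ssub hg.1, ?_⟩
  rw [← Set.union_inter_distrib_left, Set.singleton_inter_eq_empty.2 (by simpa using hfg),
    Set.union_empty]

/-- A set of naturals whose gaps are reflected into it by `x ↦ F - x` is irreducible. -/
theorem nsIrr_of_reflect {S : Set ℕ} {F : ℕ} (hF : F ∉ S)
    (hrefl : ∀ x, x ∉ S → x ≤ F ∧ F - x ∈ S) : nsIrr S := by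
  have key {T : Set ℕ} (hT : IsNumSgp T) (hST : S ⊂ T) : F ∈ T := by
    obtain ⟨t, ht, htS⟩ := Set.exists_of_ssubset hST
    obtain ⟨hle, hmem⟩ := hrefl t htS
    simpa [Nat.add_sub_cancel' hle] using hT.2.1 t ht _ (hST.1 hmem)
  rintro ⟨T₁, T₂, h₁, h₂, hs₁, hs₂, hS⟩
  exact hF (hS ▸ ⟨key h₁ hs₁, key h₂ hs₂⟩)

theorem nsFrob_eq_of_reflect {S : Set ℕ} {F : ℕ} (hF : F ∉ S)
    (hrefl : ∀ x, x ∉ S → x ≤ F ∧ F - x ∈ S) : nsFrob S = F :=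
  IsGreatest.csSup_eq ⟨hF, fun x hx => (hrefl x hx).1⟩

theorem symmetric_of_reflect {S : Set ℕ} {F : ℕ} (hF : F ∉ S)
    (hrefl : ∀ x, x ∉ S → x ≤ F ∧ F - x ∈ S) (hodd : Odd F) :
    nsIrr S ∧ nsSym S ∧ nsFrob S = F ∧ Odd F := by
  have hirr := nsIrr_of_reflect hF hrefl
  have hfrob := nsFrob_eq_of_reflect hF hrefl
  exact ⟨hirr, ⟨hirr, hfrob.symm ▸ hodd⟩, hfrob, hodd⟩

/-- If the Apéry element of `3d` is the sum of the other two, then the gaps are reflected into the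
set by `x ↦ a + b - 4 - x`. -/
theorem symmetric_aperySetFour {d a b F : ℕ} (hd : d % 4 = 1 ∨ d % 4 = 3)
    (ha : a % 4 = d % 4) (hb : b % 4 = 2 * d % 4) (hb0 : 0 < b) (hF : F + 4 = a + b) :
    nsIrr (aperySetFour d a b (a + b)) ∧ nsSym (aperySetFour d a b (a + b)) ∧
      nsFrob (aperySetFour d a b (a + b)) = F ∧ Odd F := by
  refine symmetric_of_reflect ?_ (fun x hx => ?_) (Nat.odd_iff.2 (by omega))
  · rw [mem_aperySetFour]
    omega
  · rw [mem_aperySetFour] at hx ⊢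
    have hx4 : x % 4 = d % 4 ∨ x % 4 = 2 * d % 4 ∨ x % 4 = 3 * d % 4 := by omega
    rcases hx4 with h | h | h
    · have : x + 4 ≤ a := by omega
      clear hx
      exact ⟨by omega, Or.inr (Or.inr (Or.inl (by omega)))⟩
    · have : x + 4 ≤ b := by omega
      clear hx
      exact ⟨by omega, Or.inr (Or.inl (by omega))⟩
    · have : x + 4 ≤ a + b := by omega
      clear hx
      exact ⟨by omega, Or.inl (by omega)⟩

theorem nsGen_arith_one (h d : ℕ) :
    nsGen ({4} ∪ (fun i => 4 * h + i * d) '' Set.Icc 1 1) =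
      aperySetFour d (4 * h + d) (8 * h + 2 * d) (12 * h + 3 * d) := by
  set G : Set ℕ := {4} ∪ (fun i => 4 * h + i * d) '' Set.Icc 1 1
  have ha : 4 * h + d ∈ AddSubmonoid.closure G :=
    AddSubmonoid.subset_closure (Or.inr ⟨1, by simp, by simp⟩)
  apply nsGen_eq_aperySetFour
  any_goals omega
  · rintro x (rfl | ⟨i, hi, rfl⟩)
    · exact Or.inl rfl
    · obtain rfl : i = 1 := by simpa using hi
      simp only [mem_aperySetFour]
      omega
  · exact AddSubmonoid.subset_closure (Or.inl rfl)
  · exact ha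
  · have hb := nsmul_mem ha 2
    rwa [smul_eq_mul, show 2 * (4 * h + d) = 8 * h + 2 * d by ring] at hb
  · have hc := nsmul_mem ha 3
    rwa [smul_eq_mul, show 3 * (4 * h + d) = 12 * h + 3 * d by ring] at hc

theorem nsGen_arith_two (h d : ℕ) :
    nsGen ({4} ∪ (fun i => 4 * h + i * d) '' Set.Icc 1 2) =
      aperySetFour d (4 * h + d) (4 * h + 2 * d) (8 * h + 3 * d) := by
  set G : Set ℕ := {4} ∪ (fun i => 4 * h + i * d) '' Set.Icc 1 2
  have ha : 4 * h + d ∈ AddSubmonoid.closure G :=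
    AddSubmonoid.subset_closure (Or.inr ⟨1, by simp, by simp⟩)
  have hb : 4 * h + 2 * d ∈ AddSubmonoid.closure G :=
    AddSubmonoid.subset_closure (Or.inr ⟨2, by simp, by simp⟩)
  apply nsGen_eq_aperySetFour
  any_goals omega
  · rintro x (rfl | ⟨i, ⟨hi1, hi2⟩, rfl⟩)
    · exact Or.inl rfl
    · interval_cases i <;> simp only [mem_aperySetFour] <;> omega
  · exact AddSubmonoid.subset_closure (Or.inl rfl)
  · exact ha
  · exact hb
  · have hc := add_mem ha hb
    rwa [show 4 * h + d + (4 * h + 2 * d) = 8 * h + 3 * d by ring] at hc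

theorem nsGen_arith_three (h d : ℕ) :
    nsGen ({4} ∪ (fun i => 4 * h + i * d) '' Set.Icc 1 3) =
      aperySetFour d (4 * h + d) (4 * h + 2 * d) (4 * h + 3 * d) := by
  apply nsGen_eq_aperySetFour
  any_goals omega
  · rintro x (rfl | ⟨i, ⟨hi1, hi2⟩, rfl⟩)
    · exact Or.inl rfl
    · interval_cases i <;> simp only [mem_aperySetFour] <;> omega
  · exact AddSubmonoid.subset_closure (Or.inl rfl)
  · exact AddSubmonoid.subset_closure (Or.inr ⟨1, by simp, by simp⟩)
  · exact AddSubmonoid.subset_closure (Or.inr ⟨2, by simp, by simp⟩)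
  · exact AddSubmonoid.subset_closure (Or.inr ⟨3, by simp, by simp⟩)

theorem sub_four_mem_nsSG_left {h d : ℕ} (hd : d % 4 = 1 ∨ d % 4 = 3) (hh : 1 ≤ h)
    (hd0 : 1 ≤ d) : 4 * h + 2 * d - 4 ∈
      nsSG (aperySetFour d (4 * h + d) (4 * h + 2 * d) (4 * h + 3 * d)) := by
  refine ⟨?_, isNumSgp_union_singleton (Or.inl rfl)
    (fun x hx y hy => add_mem_aperySetFour (by omega) (by omega) (by omega) (by omega) hx hy)
    (finite_compl_aperySetFour hd) ?_ fun x hx hx0 => ?_⟩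
  · rw [mem_aperySetFour]
    omega
  · exact Or.inl (by omega)
  · rw [mem_aperySetFour] at *
    rcases hx with hx | hx | hx | hx <;> omega

theorem sub_four_mem_nsSG_right {h d : ℕ} (hd : d % 4 = 1 ∨ d % 4 = 3) (hh : 1 ≤ h)
    (hd0 : 1 ≤ d) : 4 * h + 3 * d - 4 ∈
      nsSG (aperySetFour d (4 * h + d) (4 * h + 2 * d) (4 * h + 3 * d)) := by
  refine ⟨?_, isNumSgp_union_singleton (Or.inl rfl)
    (fun x hx y hy => add_mem_aperySetFour (by omega) (by omega) (by omega) (by omega) hx hy)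
    (finite_compl_aperySetFour hd) ?_ fun x hx hx0 => ?_⟩
  · rw [mem_aperySetFour]
    omega
  · exact Or.inr (Or.inr (Or.inl (by omega)))
  · rw [mem_aperySetFour] at *
    rcases hx with hx | hx | hx | hx <;> omega

/-- numerical semigroups generated by 4 and a generalized
arithmetic sequence: irreducible and symmetric for k = 1, 2 (with the stated
odd Frobenius numbers), not irreducible for k = 3. -/
theorem stmt17 (h d k : ℕ) (hh : 1 ≤ h) (hd : 1 ≤ d)
    (hgcd : Nat.gcd d 4 = 1) (hk : k = 1 ∨ k = 2 ∨ k = 3)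
    (S : Set ℕ)
    (hSdef : S = nsGen ({4} ∪ (fun i => 4 * h + i * d) '' Set.Icc 1 k)) :
    (k = 1 → nsIrr S ∧ nsSym S ∧ nsFrob S = 4 * (3 * h - 1) + 3 * d ∧
      Odd (4 * (3 * h - 1) + 3 * d)) ∧
    (k = 2 → nsIrr S ∧ nsSym S ∧ nsFrob S = 4 * (2 * h - 1) + 3 * d ∧
      Odd (4 * (2 * h - 1) + 3 * d)) ∧
    (k = 3 → ¬ nsIrr S) := by
  have hd4 : d % 4 = 1 ∨ d % 4 = 3 := by
    have hmod : Nat.gcd (d % 4) 4 = 1 := by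
      rwa [Nat.gcd_comm, Nat.gcd_rec] at hgcd
    have hlt : d % 4 < 4 := Nat.mod_lt _ (by norm_num)
    interval_cases d % 4 <;> simp_all
  refine ⟨?_, ?_, ?_⟩
  · rintro rfl
    rw [hSdef, nsGen_arith_one, show 12 * h + 3 * d = 4 * h + d + (8 * h + 2 * d) by ring]
    exact symmetric_aperySetFour hd4 (by omega) (by omega) (by omega) (by omega)
  · rintro rfl
    rw [hSdef, nsGen_arith_two, show 8 * h + 3 * d = 4 * h + d + (4 * h + 2 * d) by ring]
    exact symmetric_aperySetFour hd4 (by omega) (by omega) (by omega) (by omega)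
  · rintro rfl
    rw [hSdef, nsGen_arith_three]
    exact not_nsIrr_of_mem_nsSG (sub_four_mem_nsSG_left hd4 (by omega) (by omega))
      (sub_four_mem_nsSG_right hd4 (by omega) (by omega)) (by omega)
end
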